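/- Let n ≥ 1, let A, B : ℝ → Matrix(n, n, ℝ) be continuous with skew-symmetric values (A(τ)ᵀ = −A(τ) and B(τ)ᵀ = −B(τ) for all τ), and let x : ℝ × ℝ → Matrix(n, n, ℝ) be twice continuously differentiable with x(0, σ) = I for all σ and ∂x/∂τ(τ, σ) = x(τ, σ)·(A(τ) + σ·B(τ)) for all τ, σ. Then: (i) x(τ, 0) is an orthogonal matrix for every τ; and (ii) with h(τ) = ∫_0^τ x(ρ, 0)·B(ρ)·x(ρ, 0)ᵀ dρ, one has ∂x/∂σ(τ, 0) = h(τ)·x(τ, 0) and ∫_0^1 ‖h'(τ)‖_F² dτ = ∫_0^1 ‖B(τ)‖_F² dτ, where ‖M‖_F² = trace(MᵀM) is the Frobenius norm. Thus the differential of the Itô map θ at A is a linear isometry from L²([0,1]; skew-symmetric matrices) with the L² norm to the energy form h ↦ ∫_0^1 ‖h'(τ)‖_F² dτ. -/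

import Mathlib

open MeasureTheory Matrix

attribute [local instance] Matrix.normedAddCommGroup Matrix.normedSpace

noncomputable section


/-- The product rule for matrix-valued curves. -/
theorem Matrix.hasDerivAt_mul {n : ℕ} {u v : ℝ → Matrix (Fin n) (Fin n) ℝ}
    {u' v' : Matrix (Fin n) (Fin n) ℝ} {t : ℝ}
    (hu : HasDerivAt u u' t) (hv : HasDerivAt v v' t) :
    HasDerivAt (fun s => u s * v s) (u' * v t + u t * v') t := by
  have h := (LinearMap.mul ℝ (Matrix (Fin n) (Fin n) ℝ)).toContinuousBilinearMap
    |>.hasDerivAt_of_bilinear (fun _ => hu) (fun _ => hv)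
  exact h.congr_deriv (add_comm _ _)

/-- Transposition commutes with differentiation of matrix-valued curves. -/
theorem Matrix.hasDerivAt_transpose {n : ℕ} {u : ℝ → Matrix (Fin n) (Fin n) ℝ}
    {u' : Matrix (Fin n) (Fin n) ℝ} {t : ℝ} (hu : HasDerivAt u u' t) :
    HasDerivAt (fun s => (u s)ᵀ) u'ᵀ t :=
  ((transposeLinearEquiv (Fin n) (Fin n) ℝ ℝ).toLinearMap.toContinuousLinearMap.hasFDerivAt
    (x := u t)).comp_hasDerivAt t hu

/-- For a `C²` map on the plane, the `τ`-derivative of the `σ`-derivative is the `σ`-derivative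
of the `τ`-derivative. -/
theorem hasDerivAt_fderiv_snd_of_fderiv_fst {E : Type*} [NormedAddCommGroup E] [NormedSpace ℝ E]
    {f : ℝ × ℝ → E} (hf : ContDiff ℝ 2 f) {τ σ : ℝ} {f' : E}
    (h : HasDerivAt (fun s => fderiv ℝ f (τ, s) (1, 0)) f' σ) :
    HasDerivAt (fun t => fderiv ℝ f (t, σ) (0, 1)) f' τ := by
  have hD : HasFDerivAt (fderiv ℝ f) (fderiv ℝ (fderiv ℝ f) (τ, σ)) (τ, σ) :=
    ((hf.fderiv_right (m := 1) (by norm_num)).differentiable (by norm_num) _).hasFDerivAt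
  have hfst : HasDerivAt (fun t => fderiv ℝ f (t, σ) (0, 1))
      (fderiv ℝ (fderiv ℝ f) (τ, σ) (1, 0) (0, 1)) τ := by
    have hc := hD.comp_hasDerivAt τ ((hasDerivAt_id τ).prodMk (hasDerivAt_const τ σ))
    simpa using hc.clm_apply (hasDerivAt_const τ ((0 : ℝ), (1 : ℝ)))
  have hsnd : HasDerivAt (fun s => fderiv ℝ f (τ, s) (1, 0))
      (fderiv ℝ (fderiv ℝ f) (τ, σ) (0, 1) (1, 0)) σ := by
    have hc := hD.comp_hasDerivAt σ ((hasDerivAt_const σ τ).prodMk (hasDerivAt_id σ))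
    simpa using hc.clm_apply (hasDerivAt_const σ ((1 : ℝ), (0 : ℝ)))
  have hsymm : IsSymmSndFDerivAt ℝ f (τ, σ) := hf.contDiffAt.isSymmSndFDerivAt (by simp)
  rw [h.unique hsnd, hsymm (0, 1) (1, 0)]
  exact hfst

/-- A solution of `x' = x * A` with `A` skew-symmetric and `x 0 = 1` is orthogonal. -/
theorem Matrix.transpose_mul_self_of_hasDerivAt_mul_skew {n : ℕ}
    {A x : ℝ → Matrix (Fin n) (Fin n) ℝ} (hA : ∀ τ, (A τ)ᵀ = -A τ) (hx0 : x 0 = 1)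
    (hx : ∀ τ, HasDerivAt x (x τ * A τ) τ) (τ : ℝ) : (x τ)ᵀ * x τ = 1 := by
  have hd : ∀ t, HasDerivAt (fun s => x s * (x s)ᵀ) 0 t := fun t => by
    refine (hasDerivAt_mul (hx t) (hasDerivAt_transpose (hx t))).congr_deriv ?_
    simp [transpose_mul, hA, Matrix.mul_assoc]
  have hc := is_const_of_deriv_eq_zero (fun t => (hd t).differentiableAt)
    (fun t => (hd t).deriv) τ 0
  rw [mul_eq_one_comm]
  simpa [hx0] using hc

/-- Theorem 8.1 in matrix form: the Itô map is an isometry. With `A, B`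
continuous skew-symmetric-valued and `x(τ, σ)` solving `∂x/∂τ = x·(A(τ) + σB(τ))`,
`x(0, σ) = I`: (i) each `x(τ, 0)` is orthogonal; (ii) with
`h(τ) = ∫₀^τ x(ρ,0) B(ρ) x(ρ,0)ᵀ dρ` one has `∂x/∂σ(τ,0) = h(τ)·x(τ,0)` and
`∫₀^1 ‖h'(τ)‖_F² dτ = ∫₀^1 ‖B(τ)‖_F² dτ` (Frobenius norms). -/
theorem ito_map_isometry
    (n : ℕ) (hn : 1 ≤ n)
    (A B : ℝ → Matrix (Fin n) (Fin n) ℝ) (hA : Continuous A) (hB : Continuous B)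
    (hAskew : ∀ τ : ℝ, (A τ)ᵀ = -A τ) (hBskew : ∀ τ : ℝ, (B τ)ᵀ = -B τ)
    (x : ℝ × ℝ → Matrix (Fin n) (Fin n) ℝ) (hx : ContDiff ℝ 2 x)
    (hx0 : ∀ σ : ℝ, x (0, σ) = 1)
    (hxτ : ∀ τ σ : ℝ, fderiv ℝ x (τ, σ) (1, 0) = x (τ, σ) * (A τ + σ • B τ))
    (h : ℝ → Matrix (Fin n) (Fin n) ℝ)
    (hh : h = fun τ => ∫ ρ in (0 : ℝ)..τ, x (ρ, 0) * B ρ * (x (ρ, 0))ᵀ) :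
    (∀ τ : ℝ, (x (τ, 0))ᵀ * x (τ, 0) = 1) ∧
    (∀ τ : ℝ, fderiv ℝ x (τ, 0) (0, 1) = h τ * x (τ, 0)) ∧
    ∫ τ in (0 : ℝ)..1, Matrix.trace ((deriv h τ)ᵀ * deriv h τ)
      = ∫ τ in (0 : ℝ)..1, Matrix.trace ((B τ)ᵀ * B τ) := by
  subst hh
  have hdiff : Differentiable ℝ x := hx.differentiable (by norm_num)
  have hτ : ∀ τ, HasDerivAt (fun t => x (t, 0)) (x (τ, 0) * A τ) τ := fun τ => by
    refine ((hdiff (τ, 0)).hasFDerivAt.comp_hasDerivAt τ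
      ((hasDerivAt_id τ).prodMk (hasDerivAt_const τ (0 : ℝ)))).congr_deriv ?_
    exact (hxτ τ 0).trans (by simp)
  have hσ : ∀ τ, HasDerivAt (fun s => x (τ, s)) (fderiv ℝ x (τ, 0) (0, 1)) 0 := fun τ =>
    (hdiff (τ, 0)).hasFDerivAt.comp_hasDerivAt (0 : ℝ)
      ((hasDerivAt_const (0 : ℝ) τ).prodMk (hasDerivAt_id (0 : ℝ)))
  have horth : ∀ τ, (x (τ, 0))ᵀ * x (τ, 0) = 1 :=
    transpose_mul_self_of_hasDerivAt_mul_skew hAskew (hx0 0) hτ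
  have hcont : Continuous fun ρ => x (ρ, 0) * B ρ * (x (ρ, 0))ᵀ := by
    have hxc : Continuous fun ρ : ℝ => x (ρ, 0) := hx.continuous.comp (by fun_prop)
    exact (hxc.matrix_mul hB).matrix_mul hxc.matrix_transpose
  have hh' : ∀ τ, HasDerivAt (fun τ => ∫ ρ in (0 : ℝ)..τ, x (ρ, 0) * B ρ * (x (ρ, 0))ᵀ)
      (x (τ, 0) * B τ * (x (τ, 0))ᵀ) τ := fun τ => hcont.integral_hasStrictDerivAt 0 τ |>.hasDerivAt
  have hy : ∀ τ, HasDerivAt (fun t => fderiv ℝ x (t, 0) (0, 1))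
      (fderiv ℝ x (τ, 0) (0, 1) * A τ + x (τ, 0) * B τ) τ := fun τ => by
    refine hasDerivAt_fderiv_snd_of_fderiv_fst hx ?_
    refine HasDerivAt.congr_of_eventuallyEq ?_ (.of_forall (hxτ τ))
    have hAB : HasDerivAt (fun s : ℝ => A τ + s • B τ) (B τ) 0 :=
      (((hasDerivAt_id (0 : ℝ)).smul_const (B τ)).const_add (A τ)).congr_deriv (one_smul _ _)
    refine (hasDerivAt_mul (hσ τ) hAB).congr_deriv ?_
    simp
  have hy0 : fderiv ℝ x (0, 0) (0, 1) = 0 := by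
    refine (hσ 0).unique ?_
    simpa only [hx0] using hasDerivAt_const (0 : ℝ) (1 : Matrix (Fin n) (Fin n) ℝ)
  refine ⟨horth, fun τ => ?_, ?_⟩
  · have hd : ∀ t, HasDerivAt (fun t => fderiv ℝ x (t, 0) (0, 1) * (x (t, 0))ᵀ -
        ∫ ρ in (0 : ℝ)..t, x (ρ, 0) * B ρ * (x (ρ, 0))ᵀ) 0 t := fun t => by
      refine ((hasDerivAt_mul (hy t) (hasDerivAt_transpose (hτ t))).sub (hh' t)).congr_deriv ?_
      simp [transpose_mul, hAskew, Matrix.add_mul, Matrix.mul_assoc]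
    have hc := is_const_of_deriv_eq_zero (fun t => (hd t).differentiableAt)
      (fun t => (hd t).deriv) τ 0
    simp only [hy0, Matrix.zero_mul, intervalIntegral.integral_same, sub_self] at hc
    beta_reduce
    rw [← sub_eq_zero.mp hc, Matrix.mul_assoc, horth, Matrix.mul_one]
  · refine intervalIntegral.integral_congr fun τ _ => ?_
    have hderiv : deriv (fun τ => ∫ ρ in (0 : ℝ)..τ, x (ρ, 0) * B ρ * (x (ρ, 0))ᵀ) τ =
        x (τ, 0) * B τ * (x (τ, 0))ᵀ := (hh' τ).deriv
    have hconj : (x (τ, 0) * B τ * (x (τ, 0))ᵀ)ᵀ * (x (τ, 0) * B τ * (x (τ, 0))ᵀ) =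
        x (τ, 0) * ((B τ)ᵀ * B τ * (x (τ, 0))ᵀ) := by
      calc _ = x (τ, 0) * ((B τ)ᵀ * ((x (τ, 0))ᵀ * x (τ, 0)) * B τ * (x (τ, 0))ᵀ) := by
            simp only [transpose_mul, transpose_transpose, Matrix.mul_assoc]
        _ = _ := by rw [horth, Matrix.mul_one]
    simp only [hderiv]
    rw [hconj, trace_mul_comm, Matrix.mul_assoc, horth, Matrix.mul_one]
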